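/- arXiv:1802.06491 — 3 statements merged into one kernel-verified Lean document; each statement's English description precedes it below -/
import Mathlib

section
/- Let R be a commutative Noetherian local ring. Then R is an Artinian Gorenstein ring (i.e., R is Artinian and injective as a module over itself) if and only if every principal ideal of R is a trace ideal. -/
universe u v

/-- The trace ideal of an `R`-module `M`: the ideal of `R` generated by the images of all
`R`-linear maps `M → R`. -/
def traceIdeal (R : Type u) [CommRing R] (M : Type v) [AddCommGroup M] [Module R M] :
    Ideal R :=
  ⨆ f : M →ₗ[R] R, LinearMap.range f

/-- An ideal `I` of `R` is a trace ideal if `I = traceIdeal R N` for some `R`-module `N`. -/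
def Ideal.IsTraceIdeal {R : Type u} [CommRing R] (I : Ideal R) : Prop :=
  ∃ (N : Type u) (_ : AddCommGroup N) (_ : Module R N), I = traceIdeal R N

open IsLocalRing

/-- A principal ideal `(r)` is a trace ideal if and only if it contains every element `y`
annihilated by all annihilators of `r`. -/
theorem Ideal.isTraceIdeal_span_singleton_iff {R : Type u} [CommRing R] (r : R) :
    (Ideal.span {r}).IsTraceIdeal ↔
      ∀ y : R, (∀ a : R, a * r = 0 → a * y = 0) → r ∣ y := by
  constructor
  · rintro ⟨N, _, _, hN⟩ y hy
    let φ : R →ₗ[R] R := LinearMap.toSpanSingleton R R r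
    have hker : LinearMap.ker φ ≤ LinearMap.ker (LinearMap.toSpanSingleton R R y) := by
      intro a ha
      simpa using hy a (by simpa [φ] using ha)
    have hrange : ∀ x : Ideal.span {r}, (x : R) ∈ LinearMap.range φ := by
      intro x
      simp [φ, LinearMap.range_toSpanSingleton]
    let g : Ideal.span {r} →ₗ[R] R :=
      (LinearMap.ker φ).liftQ _ hker ∘ₗ φ.quotKerEquivRange.symm.toLinearMap ∘ₗ
        LinearMap.codRestrict _ (Ideal.span {r}).subtype hrange
    have hg : g ⟨r, Ideal.mem_span_singleton_self r⟩ = y := by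
      have h : LinearMap.codRestrict _ (Ideal.span {r}).subtype hrange
          ⟨r, Ideal.mem_span_singleton_self r⟩ = φ.quotKerEquivRange (Submodule.Quotient.mk 1) :=
        Subtype.ext (one_smul R r).symm
      simp only [g, LinearMap.comp_apply, h, LinearEquiv.coe_coe, LinearEquiv.symm_apply_apply]
      exact one_smul R y
    have hle : ∀ f : N →ₗ[R] R, ∀ n, f n ∈ Ideal.span {r} := fun f n ↦ by
      rw [hN]
      exact (le_iSup (fun f : N →ₗ[R] R ↦ LinearMap.range f) f) ⟨n, rfl⟩
    have hsub : ∀ x (hx : x ∈ Ideal.span {r}), g ⟨x, hx⟩ ∈ Ideal.span {r} := by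
      have hall : Ideal.span {r} ≤ Submodule.map (Ideal.span {r}).subtype
          (Submodule.comap g (Ideal.span {r})) := by
        conv_lhs => rw [hN]
        refine iSup_le fun f ↦ ?_
        rintro _ ⟨n, rfl⟩
        exact ⟨⟨f n, hle f n⟩, hle (g ∘ₗ LinearMap.codRestrict _ f (hle f)) n, rfl⟩
      intro x hx
      obtain ⟨z, hz, rfl⟩ := hall hx
      exact hz
    rw [← Ideal.mem_span_singleton, ← hg]
    exact hsub _ _
  · intro h
    refine ⟨Ideal.span {r}, inferInstance, inferInstance, le_antisymm ?_ ?_⟩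
    · refine le_trans ?_ (le_iSup _ (Ideal.span {r}).subtype)
      rw [Submodule.range_subtype]
    · refine iSup_le fun f ↦ ?_
      rintro _ ⟨⟨x, hx⟩, rfl⟩
      obtain ⟨c, rfl⟩ := Ideal.mem_span_singleton'.mp hx
      have hc : (⟨c * r, hx⟩ : Ideal.span {r}) = c • ⟨r, Ideal.mem_span_singleton_self r⟩ := rfl
      rw [hc, map_smul]
      refine Ideal.mul_mem_left _ _ (Ideal.mem_span_singleton.mpr (h _ fun a ha ↦ ?_))
      rw [← smul_eq_mul, ← map_smul]
      convert map_zero f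
      exact Subtype.ext ha

/-- In a self-injective ring every ideal is a trace ideal. -/
theorem Ideal.isTraceIdeal_of_injective {R : Type u} [CommRing R] (hR : Module.Injective R R)
    (I : Ideal R) : I.IsTraceIdeal := by
  refine ⟨I, inferInstance, inferInstance, le_antisymm ?_ ?_⟩
  · refine le_trans ?_ (le_iSup _ I.subtype)
    rw [Submodule.range_subtype]
  · refine iSup_le fun f ↦ ?_
    rintro _ ⟨⟨x, hx⟩, rfl⟩
    obtain ⟨g, hg⟩ := Module.Baer.of_injective hR I f
    rw [← hg x hx, ← mul_one x, ← smul_eq_mul, map_smul]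
    exact I.mul_mem_right _ hx

/-- A Noetherian local ring in which every `(r)` is its own double annihilator is Artinian. -/
theorem isArtinianRing_of_dvd_of_annihilator {R : Type u} [CommRing R] [IsNoetherianRing R]
    [IsLocalRing R] (h : ∀ r y : R, (∀ a : R, a * r = 0 → a * y = 0) → r ∣ y) :
    IsArtinianRing R := by
  rw [isArtinianRing_iff_isNilpotent_maximalIdeal,
    Ideal.FG.isNilpotent_iff_le_nilradical (IsNoetherian.noetherian _)]
  intro x hx
  obtain ⟨n, hn⟩ := monotone_stabilizes_iff_noetherian.mpr inferInstance
    (LinearMap.mulLeft R x).iterateKer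
  obtain ⟨c, hc⟩ := h (x ^ (n + 1)) (x ^ n) fun a ha ↦ by
    have : a ∈ (LinearMap.mulLeft R x).iterateKer n := by
      rw [hn (n + 1) n.le_succ]
      simpa [LinearMap.iterateKer, LinearMap.pow_mulLeft, mul_comm] using ha
    simpa [LinearMap.iterateKer, LinearMap.pow_mulLeft, mul_comm] using this
  refine ⟨n, ?_⟩
  have hu : IsUnit (1 - x * c) := by
    by_contra hu
    have hsum := (maximalIdeal R).add_mem ((mem_maximalIdeal _).mpr hu)
      ((maximalIdeal R).mul_mem_right c hx)
    rw [sub_add_cancel] at hsum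
    exact (maximalIdeal.isMaximal R).isPrime.one_notMem hsum
  rw [Ideal.zero_eq_bot, Ideal.mem_bot, ← hu.mul_left_eq_zero]
  linear_combination hc

/-- Additivity of length for a submodule and its quotient. -/
theorem Submodule.length_eq_add_quotient {R M : Type*} [Ring R] [AddCommGroup M] [Module R M]
    (N : Submodule R M) :
    Module.length R M = Module.length R N + Module.length R (M ⧸ N) :=
  Module.length_eq_add_of_exact N.subtype N.mkQ N.subtype_injective N.mkQ_surjective
    (LinearMap.exact_subtype_mkQ N)

/-- Additivity of length for the sequence `0 → Hom(M ⧸ N, Q) → Hom(M, Q) → Hom(N, Q)`. -/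
theorem Module.length_linearMap_eq_add_range {R M Q : Type*} [CommRing R] [AddCommGroup M]
    [Module R M] [AddCommGroup Q] [Module R Q] (N : Submodule R M) :
    Module.length R (M →ₗ[R] Q) = Module.length R ((M ⧸ N) →ₗ[R] Q) +
      Module.length R (LinearMap.range (LinearMap.lcomp R Q N.subtype)) := by
  refine Module.length_eq_add_of_exact (LinearMap.lcomp R Q N.mkQ)
    (LinearMap.lcomp R Q N.subtype).rangeRestrict
    (LinearMap.lcomp_injective_of_surjective _ N.mkQ_surjective)
    (LinearMap.surjective_rangeRestrict _) ?_
  intro f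
  constructor
  · intro hf
    have hf' : N ≤ LinearMap.ker f := fun x hx ↦
      LinearMap.congr_fun (congrArg Subtype.val hf) ⟨x, hx⟩
    exact ⟨N.liftQ f hf', N.liftQ_mkQ f hf'⟩
  · rintro ⟨g, rfl⟩
    ext x
    change g (N.mkQ x) = 0
    rw [N.mkQ_apply, (Submodule.Quotient.mk_eq_zero N).mpr x.2, map_zero]

/-- If the functor `Hom(-, Q)` sends simple modules to modules of length at most one, it does not
increase the length of modules of finite length. -/
theorem IsFiniteLength.length_linearMap_le {R : Type u} {Q : Type*} [CommRing R] [AddCommGroup Q]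
    [Module R Q]
    (h : ∀ (S : Type v) [AddCommGroup S] [Module R S] [IsSimpleModule R S],
      Module.length R (S →ₗ[R] Q) ≤ 1)
    {M : Type v} [AddCommGroup M] [Module R M] (hM : IsFiniteLength R M) :
    Module.length R (M →ₗ[R] Q) ≤ Module.length R M := by
  induction hM with
  | of_subsingleton => simp
  | @of_simple_quotient M _ _ N _ _ ih =>
    rw [Module.length_linearMap_eq_add_range N, add_comm,
      N.length_eq_add_quotient, Module.length_eq_one R (M ⧸ N)]
    exact add_le_add ((Module.length_le_of_injective _ (Submodule.subtype_injective _)).trans ih)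
      (h _)

/-- If the socle of a local ring is generated by one element, then `Hom(S, R)` has length at most
one for every simple module `S`. -/
theorem IsLocalRing.length_linearMap_le_one {R : Type u} [CommRing R] [IsLocalRing R] {z : R}
    (hz : ∀ a ∈ maximalIdeal R, a * z = 0)
    (hdvd : ∀ y : R, (∀ a ∈ maximalIdeal R, a * y = 0) → z ∣ y)
    (S : Type v) [AddCommGroup S] [Module R S] [IsSimpleModule R S] :
    Module.length R (S →ₗ[R] R) ≤ 1 := by
  let φ : R →ₗ[R] R := LinearMap.toSpanSingleton R R z
  have hφ : Module.length R (LinearMap.range φ) ≤ 1 := by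
    have hle : maximalIdeal R ≤ LinearMap.ker φ := fun a ha ↦ by simpa [φ] using hz a ha
    have : IsSimpleModule R (R ⧸ maximalIdeal R) :=
      isSimpleModule_iff_isCoatom.mpr (maximalIdeal.isMaximal R).out
    rw [← φ.quotKerEquivRange.length_eq, ← Module.length_eq_one R (R ⧸ maximalIdeal R)]
    exact Module.length_le_of_surjective _ (Submodule.factor_surjective hle)
  have hann : Module.annihilator R S = maximalIdeal R :=
    eq_maximalIdeal IsSimpleModule.annihilator_isMaximal
  have := IsSimpleModule.nontrivial R S
  obtain ⟨s, hs⟩ := exists_ne (0 : S)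
  have hmem : ∀ f : S →ₗ[R] R, LinearMap.applyₗ s f ∈ LinearMap.range φ := by
    intro f
    obtain ⟨c, hc⟩ := hdvd (f s) fun a ha ↦ by
      rw [← smul_eq_mul, ← map_smul, Module.mem_annihilator.mp (hann ▸ ha) s, map_zero]
    exact ⟨c, by simp [φ, hc, mul_comm]⟩
  refine (Module.length_le_of_injective
    (LinearMap.codRestrict _ (LinearMap.applyₗ s) hmem) ?_).trans hφ
  rw [← LinearMap.ker_eq_bot, LinearMap.ker_eq_bot']
  intro f hf
  refine f.injective_or_eq_zero.resolve_left fun hinj ↦ hs (hinj ?_)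
  rw [map_zero]
  exact congrArg Subtype.val hf

/-- An Artinian local ring whose socle is generated by one element is self-injective. -/
theorem IsLocalRing.injective_self_of_socle {R : Type u} [CommRing R] [IsLocalRing R]
    [IsArtinianRing R] {z : R} (hz : ∀ a ∈ maximalIdeal R, a * z = 0)
    (hdvd : ∀ y : R, (∀ a ∈ maximalIdeal R, a * y = 0) → z ∣ y) : Module.Injective R R := by
  refine Module.Baer.injective (Module.Baer.iff_surjective.mpr fun I ↦ ?_)
  have hS : ∀ (S : Type u) [AddCommGroup S] [Module R S] [IsSimpleModule R S],
      Module.length R (S →ₗ[R] R) ≤ 1 := fun S ↦ length_linearMap_le_one hz hdvd S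
  have hI := Module.length_ne_top (R := R) (M := I)
  have hQ := Module.length_ne_top (R := R) (M := R ⧸ I)
  have hI' := (Module.length_ne_top_iff.mp hI).length_linearMap_le hS
  have hQ' := (Module.length_ne_top_iff.mp hQ).length_linearMap_le hS
  have h₁ := Module.length_linearMap_eq_add_range (Q := R) I
  rw [(LinearMap.ringLmapEquivSelf R R R).length_eq] at h₁
  have h₂ := Submodule.length_eq_add_quotient I
  set X := LinearMap.range (LinearMap.lcomp R R I.subtype)
  have h₃ := Submodule.length_eq_add_quotient X
  have hcoker : Module.length R ((I →ₗ[R] R) ⧸ X) = 0 := by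
    have hD := ne_top_of_le_ne_top hI hI'
    have hE := ne_top_of_le_ne_top hQ hQ'
    rw [h₃] at hD hI'
    have hX := ne_top_of_le_ne_top hD le_self_add
    have hC := ne_top_of_le_ne_top hD le_add_self
    generalize Module.length R ((I →ₗ[R] R) ⧸ X) = c at *
    generalize Module.length R X = x at *
    generalize Module.length R I = i at *
    generalize Module.length R (R ⧸ I) = q at *
    generalize Module.length R ((R ⧸ I) →ₗ[R] R) = e at *
    rw [h₁] at h₂
    lift c to ℕ using hC
    lift x to ℕ using hX
    lift i to ℕ using hI
    lift q to ℕ using hQ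
    lift e to ℕ using hE
    norm_cast at *
    omega
  rw [Module.length_eq_zero_iff, Submodule.Quotient.subsingleton_iff] at hcoker
  exact LinearMap.range_eq_top.mp hcoker

theorem stmt_1 (R : Type u) [CommRing R] [IsNoetherianRing R] [IsLocalRing R] :
    (IsArtinianRing R ∧ Module.Injective R R) ↔
      ∀ r : R, (Ideal.span {r}).IsTraceIdeal := by
  refine ⟨fun h r ↦ Ideal.isTraceIdeal_of_injective h.2 _, fun h ↦ ?_⟩
  have hdvd := fun r ↦ (Ideal.isTraceIdeal_span_singleton_iff r).mp (h r)
  have hart : IsArtinianRing R := isArtinianRing_of_dvd_of_annihilator hdvd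
  refine ⟨hart, ?_⟩
  obtain ⟨p, hp⟩ := associatedPrimes.nonempty R R
  obtain ⟨hprime, z, hz⟩ := isAssociatedPrime_iff.mp hp
  have hmax : maximalIdeal R = p := (eq_maximalIdeal inferInstance).symm
  have hmem : ∀ a : R, a ∈ maximalIdeal R ↔ a * z = 0 := fun a ↦ by
    rw [hmax, hz]
    simp [Submodule.mem_colon_singleton]
  exact injective_self_of_socle (fun a ↦ (hmem a).mp) fun y hy ↦
    hdvd z y fun a ha ↦ hy a ((hmem a).mpr ha)
end

section
/- Let R be a commutative local Artinian ring. Then R is Gorenstein (i.e., injective as a module over itself) if and only if I = Ann_R(Ann_R(I)) for every ideal I of R. -/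
universe u v

theorem Ideal.annihilator_inf_of_forall_annihilator_annihilator {R : Type u} [CommRing R]
    (h : ∀ I : Ideal R, I = I.annihilator.annihilator) (I J : Ideal R) :
    (I ⊓ J).annihilator = I.annihilator ⊔ J.annihilator := by
  rw [h (I.annihilator ⊔ J.annihilator), Submodule.annihilator_sup, ← h I, ← h J]

theorem Module.Baer.of_forall_annihilator_annihilator {R : Type u} [CommRing R]
    [IsNoetherianRing R] (h : ∀ I : Ideal R, I = I.annihilator.annihilator) :
    Module.Baer R R := by
  suffices H : ∀ (I : Ideal R) (_ : I.FG) (g : I →ₗ[R] R),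
      ∃ z : R, ∀ (a : R) (ha : a ∈ I), g ⟨a, ha⟩ = z * a by
    intro I g
    obtain ⟨z, hz⟩ := H I (IsNoetherian.noetherian I) g
    exact ⟨LinearMap.mulLeft R z, fun a ha => (hz a ha).symm⟩
  intro I hI
  induction I, hI using Submodule.fg_induction with
  | singleton a =>
    intro g
    have ha : a ∈ Submodule.span R {a} := Submodule.mem_span_singleton_self a
    have hg : g ⟨a, ha⟩ ∈ Submodule.span R {a} := by
      refine (h (Submodule.span R {a})).ge (Submodule.mem_annihilator.2 fun c hc => ?_)
      have hca : c • (⟨a, ha⟩ : Submodule.span R {a}) = 0 :=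
        Subtype.ext (Submodule.mem_annihilator.1 hc a ha)
      rw [smul_eq_mul, mul_comm, ← smul_eq_mul, ← map_smul, hca, map_zero]
    obtain ⟨z, hz⟩ := Submodule.mem_span_singleton.1 hg
    refine ⟨z, fun b hb => ?_⟩
    obtain ⟨c, rfl⟩ := Submodule.mem_span_singleton.1 hb
    have hcb : (⟨c • a, hb⟩ : Submodule.span R {a}) = c • ⟨a, ha⟩ := rfl
    rw [hcb, map_smul, ← hz, smul_eq_mul, smul_eq_mul, smul_eq_mul, mul_left_comm]
  | sup I J _ _ hI hJ =>
    intro g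
    obtain ⟨x, hx⟩ := hI (g ∘ₗ Submodule.inclusion le_sup_left)
    obtain ⟨y, hy⟩ := hJ (g ∘ₗ Submodule.inclusion le_sup_right)
    have hxy : x - y ∈ Submodule.annihilator (I ⊓ J) := by
      rw [Submodule.mem_annihilator]
      rintro a ⟨haI, haJ⟩
      rw [smul_eq_mul, sub_mul, ← hx a haI, ← hy a haJ]
      exact sub_self _
    rw [Ideal.annihilator_inf_of_forall_annihilator_annihilator h, Submodule.mem_sup] at hxy
    obtain ⟨s, hs, t, ht, hst⟩ := hxy
    refine ⟨x - s, fun c hc => ?_⟩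
    obtain ⟨a, ha, b, hb, rfl⟩ := Submodule.mem_sup.1 hc
    have hga : g ⟨a, le_sup_left (a := I) ha⟩ = x * a := hx a ha
    have hgb : g ⟨b, le_sup_right (a := I) hb⟩ = y * b := hy b hb
    have hsplit : (⟨a + b, hc⟩ : ↥(I ⊔ J)) =
        ⟨a, le_sup_left (a := I) ha⟩ + ⟨b, le_sup_right (a := I) hb⟩ := rfl
    have hsa : s * a = 0 := Submodule.mem_annihilator.1 hs a ha
    have htb : t * b = 0 := Submodule.mem_annihilator.1 ht b hb
    rw [hsplit, map_add, hga, hgb]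
    linear_combination hsa - htb + b * hst

theorem IsLocalRing.exists_ne_zero_forall_mem_maximalIdeal_mul_eq_zero (R : Type u) [CommRing R]
    [IsLocalRing R] [IsArtinianRing R] :
    ∃ s : R, s ≠ 0 ∧ ∀ c ∈ IsLocalRing.maximalIdeal R, c * s = 0 := by
  obtain ⟨P, hP⟩ := associatedPrimes.nonempty R R
  obtain ⟨hprime, s, hs⟩ := isAssociatedPrime_iff.1 hP
  have hmem (c : R) : c ∈ P ↔ c * s = 0 := by simp [hs, Submodule.mem_colon_singleton]
  have hmax : P = IsLocalRing.maximalIdeal R :=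
    IsLocalRing.eq_maximalIdeal (IsArtinianRing.isMaximal_of_isPrime P)
  refine ⟨s, fun h0 => hprime.ne_top ((Ideal.eq_top_iff_one P).2 ?_), fun c hc => ?_⟩
  · rw [hmem, h0, mul_zero]
  · rwa [← hmem, hmax]

theorem Module.Injective.eq_annihilator_annihilator {R : Type u} [CommRing R] [IsLocalRing R]
    [IsArtinianRing R] (hR : Module.Injective R R) (I : Ideal R) :
    I = I.annihilator.annihilator := by
  refine le_antisymm (fun x hx => Submodule.mem_annihilator.2 fun c hc => ?_) fun x hx => ?_
  · rw [smul_eq_mul, mul_comm]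
    exact Submodule.mem_annihilator.1 hc x hx
  by_contra hxI
  obtain ⟨s, hs0, hs⟩ := IsLocalRing.exists_ne_zero_forall_mem_maximalIdeal_mul_eq_zero R
  let f : (R ⧸ I) →ₗ.[R] R := LinearPMap.mkSpanSingleton' (Submodule.Quotient.mk x) s
    fun c hc => hs c <| (IsLocalRing.mem_maximalIdeal c).2 fun hu => hxI <| by
      rw [← Submodule.Quotient.mk_smul, Submodule.Quotient.mk_eq_zero] at hc
      exact (Ideal.unit_mul_mem_iff_mem I hu).1 hc
  obtain ⟨g, hg⟩ := hR.out f.domain.subtype f.domain.injective_subtype f.toFun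
  have hmem : (Submodule.Quotient.mk x : R ⧸ I) ∈ f.domain := Submodule.mem_span_singleton_self _
  have hgx : g (Submodule.Quotient.mk x) = s :=
    (hg ⟨_, hmem⟩).trans (LinearPMap.mkSpanSingleton'_apply_self _ _ _ hmem)
  have hsmul (c : R) : g (Submodule.Quotient.mk c) = c * g (Submodule.Quotient.mk 1) := by
    rw [← smul_eq_mul, ← map_smul, ← Submodule.Quotient.mk_smul, smul_eq_mul, mul_one]
  have hann : g (Submodule.Quotient.mk 1) ∈ I.annihilator := by
    rw [Submodule.mem_annihilator]
    intro c hc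
    rw [smul_eq_mul, mul_comm, ← hsmul, (Submodule.Quotient.mk_eq_zero I).2 hc, map_zero]
  exact hs0 <| by rw [← hgx, hsmul]; exact Submodule.mem_annihilator.1 hx _ hann

theorem stmt_8 (R : Type u) [CommRing R] [IsLocalRing R] [IsArtinianRing R] :
    Module.Injective R R ↔ ∀ I : Ideal R, I = I.annihilator.annihilator :=
  ⟨fun hR I => hR.eq_annihilator_annihilator I,
    fun h => (Module.Baer.of_forall_annihilator_annihilator h).injective⟩
end

section
/- Let k be a field, R = k[x,y,z] the polynomial ring in three variables, and I = (xy, xz). Then the trace ideal of I is τ_R(I) = (y, z); in particular, I is not a trace ideal although I is isomorphic as an R-module to the trace ideal (y,z). -/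
universe u v

open MvPolynomial

section TraceIdeal

variable {R : Type*} [CommRing R]

theorem apply_mem_traceIdeal {M : Type*} [AddCommGroup M] [Module R M] (f : M →ₗ[R] R) (m : M) :
    f m ∈ traceIdeal R M :=
  le_iSup (fun g : M →ₗ[R] R => LinearMap.range g) f ⟨m, rfl⟩

theorem traceIdeal_le_iff {M : Type*} [AddCommGroup M] [Module R M] {J : Ideal R} :
    traceIdeal R M ≤ J ↔ ∀ (f : M →ₗ[R] R) (m : M), f m ∈ J := by
  refine ⟨fun h f m => h (apply_mem_traceIdeal f m), fun h => iSup_le fun f => ?_⟩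
  rintro _ ⟨m, rfl⟩
  exact h f m

theorem traceIdeal_le_of_surjective {M N : Type*} [AddCommGroup M] [Module R M] [AddCommGroup N]
    [Module R N] (p : M →ₗ[R] N) (hp : Function.Surjective p) :
    traceIdeal R N ≤ traceIdeal R M := by
  refine traceIdeal_le_iff.2 fun f n => ?_
  obtain ⟨m, rfl⟩ := hp n
  exact apply_mem_traceIdeal (f ∘ₗ p) m

theorem traceIdeal_congr {M N : Type*} [AddCommGroup M] [Module R M] [AddCommGroup N]
    [Module R N] (e : M ≃ₗ[R] N) : traceIdeal R M = traceIdeal R N :=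
  le_antisymm (traceIdeal_le_of_surjective e.symm.toLinearMap e.symm.surjective)
    (traceIdeal_le_of_surjective e.toLinearMap e.surjective)

theorem Ideal.le_traceIdeal (J : Ideal R) : J ≤ traceIdeal R J :=
  fun a ha => apply_mem_traceIdeal (Submodule.subtype J) ⟨a, ha⟩

/-- A trace ideal is its own trace. -/
theorem Ideal.IsTraceIdeal.traceIdeal_eq {J : Ideal R} (hJ : J.IsTraceIdeal) :
    traceIdeal R J = J := by
  refine le_antisymm (traceIdeal_le_iff.2 fun f => ?_) J.le_traceIdeal
  obtain ⟨N, _, _, hN⟩ := hJ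
  have hmem (g : N →ₗ[R] R) (n : N) : g n ∈ J := hN ▸ apply_mem_traceIdeal g n
  have hle : J ≤ (Submodule.comap f J).map (Submodule.subtype J) := by
    conv_lhs => rw [hN]
    refine traceIdeal_le_iff.2 fun g n => ⟨⟨g n, hmem g n⟩, ?_, rfl⟩
    change f ⟨g n, hmem g n⟩ ∈ J
    have h := apply_mem_traceIdeal (f ∘ₗ g.codRestrict J (hmem g)) n
    rwa [← hN] at h
  intro m
  obtain ⟨m', hm', h⟩ := hle m.2
  rwa [← Subtype.ext h]

theorem traceIdeal_span_pair [IsDomain R] {a b : R} (ha : Prime a) (hab : ¬ a ∣ b) :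
    traceIdeal R (Ideal.span {a, b}) = Ideal.span {a, b} := by
  refine le_antisymm (traceIdeal_le_iff.2 fun f m => ?_) (Ideal.le_traceIdeal _)
  let a' : Ideal.span {a, b} := ⟨a, Ideal.subset_span (by simp)⟩
  have hf (n : Ideal.span {a, b}) : a * f n = n * f a' := by
    rw [← smul_eq_mul, ← smul_eq_mul, ← map_smul, ← map_smul]
    exact congrArg f (Subtype.ext (mul_comm _ _))
  have hdvd : a ∣ f a' :=
    (ha.dvd_or_dvd ⟨_, (hf ⟨b, Ideal.subset_span (by simp)⟩).symm⟩).resolve_left hab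
  obtain ⟨c, hc⟩ := hdvd
  have hm : f m = c * m := mul_left_cancel₀ ha.ne_zero (by rw [hf, hc]; ring)
  rw [hm]
  exact Ideal.mul_mem_left _ c m.2

/-- Multiplication by a nonzero `c` identifies `(a, b)` with `(c * a, c * b)`. -/
noncomputable def spanPairMulEquiv [IsDomain R] {c : R} (hc : c ≠ 0) (a b : R) :
    Ideal.span {a, b} ≃ₗ[R] Ideal.span {c * a, c * b} :=
  (Submodule.equivMapOfInjective (LinearMap.mulLeft R c) (mul_right_injective₀ hc)
    (Ideal.span {a, b})).trans <| LinearEquiv.ofEq _ _ <| by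
      simp [Ideal.span, Submodule.map_span, Set.image_pair]

end TraceIdeal

theorem stmt_16 (k : Type*) [Field k]
    (I : Ideal (MvPolynomial (Fin 3) k)) (hI : I = Ideal.span {X 0 * X 1, X 0 * X 2}) :
    traceIdeal (MvPolynomial (Fin 3) k) I = Ideal.span {X 1, X 2} ∧
      ¬ I.IsTraceIdeal ∧
      Nonempty (I ≃ₗ[MvPolynomial (Fin 3) k]
        (Ideal.span {(X 1 : MvPolynomial (Fin 3) k), X 2})) := by
  subst hI
  let e := spanPairMulEquiv (X_ne_zero (R := k) (0 : Fin 3)) (X 1) (X 2)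
  have htrace : traceIdeal (MvPolynomial (Fin 3) k)
      (Ideal.span {(X 0 * X 1 : MvPolynomial (Fin 3) k), X 0 * X 2}) = Ideal.span {X 1, X 2} :=
    (traceIdeal_congr e.symm).trans
      (traceIdeal_span_pair (X_prime (R := k)) (by simp [X_dvd_X]))
  refine ⟨htrace, fun h => ?_, ⟨e.symm⟩⟩
  have hmem : (X 1 : MvPolynomial (Fin 3) k) ∈ Ideal.span {X 0 * X 1, X 0 * X 2} := by
    rw [← h.traceIdeal_eq, htrace]
    exact Ideal.subset_span (by simp)
  obtain ⟨p, q, hpq⟩ := Ideal.mem_span_pair.1 hmem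
  have hdvd : (X 0 : MvPolynomial (Fin 3) k) ∣ X 1 :=
    ⟨p * X 1 + q * X 2, by rw [mul_add, mul_left_comm, mul_left_comm (X 0) q, hpq]⟩
  simp [X_dvd_X] at hdvd
end
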